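/- The completed Eisenstein series E_2(τ) = E_2^hol(τ) - 3/(π Im τ) is modular of weight 2 for SL(2,ℤ): for every γ = [[a,b],[c,d]] ∈ SL(2,ℤ) and every τ ∈ ℍ, one has (cτ+d)^{-2}·E_2((aτ+b)/(cτ+d)) = E_2(τ). -/

import Mathlib

open Complex

/-- `σ₁(n)`, the sum of the divisors of `n`. -/
def sigma1 (n : ℕ) : ℕ := ∑ d ∈ n.divisors, d

/-- The quasimodular Eisenstein series `E₂^hol(τ) = 1 - 24 Σ_{n≥1} σ₁(n) e^{2πinτ}`. -/
noncomputable def E2hol (τ : ℂ) : ℂ :=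
  1 - 24 * ∑' n : ℕ, (sigma1 (n + 1) : ℂ) *
    Complex.exp (2 * Real.pi * Complex.I * ((n : ℂ) + 1) * τ)

/-- The completed Eisenstein series `E₂(τ) = E₂^hol(τ) - 3/(π Im τ)`. -/
noncomputable def E2 (τ : ℂ) : ℂ :=
  E2hol τ - 3 / ((Real.pi : ℂ) * (τ.im : ℂ))

/-- `E2hol` agrees on the upper half plane with Mathlib's `EisensteinSeries.E2`. -/
lemma E2hol_coe (z : UpperHalfPlane) : E2hol z = EisensteinSeries.E2 z := by
  rw [E2hol, EisensteinSeries.E2_eq_tsum_cexp, tsum_pnat_eq_tsum_succ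
    (f := fun n ↦ (ArithmeticFunction.sigma 1 n : ℂ) * cexp (2 * Real.pi * I * z) ^ n)]
  congr 2
  refine tsum_congr fun n ↦ ?_
  rw [← Complex.exp_nat_mul, sigma1, ArithmeticFunction.sigma_one_apply]
  push_cast
  congr 2
  ring

/-- The quasimodular transformation law of `E2hol`. -/
lemma E2hol_smul (γ : Matrix.SpecialLinearGroup (Fin 2) ℤ) (z : UpperHalfPlane) :
    ((γ 1 0 : ℂ) * z + γ 1 1) ^ (-2 : ℤ) * E2hol (γ • z : UpperHalfPlane) =
      E2hol z - 6 * I * γ 1 0 / (Real.pi * ((γ 1 0 : ℂ) * z + γ 1 1)) := by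
  have h := congrFun (EisensteinSeries.E2_slash_action γ) z
  rw [ModularForm.SL_slash_apply] at h
  simp only [Pi.sub_apply, Pi.smul_apply, smul_eq_mul, EisensteinSeries.D2,
    ModularGroup.denom_apply, riemannZeta_two] at h
  rw [E2hol_coe, E2hol_coe, mul_comm, h]
  have hπ : (Real.pi : ℂ) ≠ 0 := by exact_mod_cast Real.pi_ne_zero
  congr 1
  field_simp

/-- `E₂` is modular of weight `2` for `SL(2,ℤ)`. -/
theorem E2_modular (γ : Matrix.SpecialLinearGroup (Fin 2) ℤ) (τ : ℂ) (hτ : 0 < τ.im) :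
    ((γ 1 0 : ℂ) * τ + (γ 1 1 : ℂ)) ^ (-2 : ℤ) *
        E2 (((γ 0 0 : ℂ) * τ + (γ 0 1 : ℂ)) / ((γ 1 0 : ℂ) * τ + (γ 1 1 : ℂ)))
      = E2 τ := by
  lift τ to UpperHalfPlane using hτ with z
  have hsmul : ((γ 0 0 : ℂ) * z + γ 0 1) / ((γ 1 0 : ℂ) * z + γ 1 1) =
      (γ • z : UpperHalfPlane) := by
    rw [UpperHalfPlane.coe_specialLinearGroup_apply]
    simp
  have him : ((γ • z : UpperHalfPlane) : ℂ).im =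
      (z : ℂ).im / normSq ((γ 1 0 : ℂ) * z + γ 1 1) := by
    rw [UpperHalfPlane.coe_im, ModularGroup.im_smul_eq_div_normSq, ModularGroup.denom_apply,
      UpperHalfPlane.coe_im]
  have hj : (γ 1 0 : ℂ) * z + γ 1 1 ≠ 0 := by
    rw [← ModularGroup.denom_apply]
    exact UpperHalfPlane.denom_ne_zero _ z
  have hsub : ((γ 1 0 : ℂ) * z + γ 1 1) - (starRingEnd ℂ) ((γ 1 0 : ℂ) * z + γ 1 1) =
      2 * I * γ 1 0 * (z : ℂ).im := by
    rw [sub_conj]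
    simp
    ring
  have hπ : (Real.pi : ℂ) ≠ 0 := by exact_mod_cast Real.pi_ne_zero
  have hy : ((z : ℂ).im : ℂ) ≠ 0 := by exact_mod_cast z.im_ne_zero
  rw [hsmul, E2, mul_sub, E2hol_smul, him, E2, ofReal_div, normSq_eq_conj_mul_self]
  generalize (γ 1 0 : ℂ) * z + γ 1 1 = j at *
  have hj' : (starRingEnd ℂ) j ≠ 0 := (map_ne_zero _).2 hj
  rw [zpow_neg, zpow_ofNat]
  field_simp
  linear_combination 3 * hsub
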